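/- arXiv:0803.4054 — 4 statements merged into one kernel-verified Lean document; each statement's English description precedes it below -/
import Mathlib

section
/- Let μ be an IYB morphism of a finite group G. Define a binary operation * on the underlying set of G by a * b = a·μ(a)⁻¹(b). Then * is associative and commutative, the identity element 1 of G is an identity for *, every element has an inverse for *, so (G, *) is an abelian group; moreover for every g ∈ G the permutation μ(g) is an automorphism of (G, *), and gh = g * μ(g)(h) for all g, h ∈ G, so the identity map is a bijective 1-cocycle from G to (G, *) with respect to the action given by μ. -/
/-- If `μ` is an IYB morphism of a finite group `G` and `*` is the
operation `a * b = a · μ(a)⁻¹(b)`, then `(G, *)` is an abelian group with identity `1`,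
each `μ(g)` is an automorphism of `(G, *)`, and `gh = g * μ(g)(h)`, so the identity
map is a bijective 1-cocycle from `G` to `(G, *)`. -/
theorem stmt_1 {G : Type*} [Group G] [Finite G]
    (μ : G →* Equiv.Perm G)
    (hμ : ∀ x y : G, x * (μ x)⁻¹ y = y * (μ y)⁻¹ x)
    (star : G → G → G)
    (hstar : ∀ a b : G, star a b = a * (μ a)⁻¹ b) :
    (∀ a b c : G, star (star a b) c = star a (star b c)) ∧
    (∀ a b : G, star a b = star b a) ∧
    (∀ a : G, star 1 a = a ∧ star a 1 = a) ∧
    (∀ a : G, ∃ b : G, star a b = 1 ∧ star b a = 1) ∧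
    (∀ g a b : G, μ g (star a b) = star (μ g a) (μ g b)) ∧
    (∀ g h : G, g * h = star g (μ g h)) := by
  have hcomm : ∀ a b : G, star a b = star b a := fun a b => by
    rw [hstar, hstar, hμ]
  have hcocycle : ∀ g h : G, g * h = star g (μ g h) := fun g h => by simp [hstar]
  have hone : ∀ a : G, star 1 a = a := fun a => by simp [hstar]
  have hcancel : ∀ a b c : G, star a b = star a c → b = c := fun a b c h => by
    simpa [hstar] using h
  have hkey : ∀ a b c : G, star (star a (μ a b)) (μ a c) = star a (μ a (star b c)) :=
    fun a b c => by
      rw [← hcocycle, ← hcocycle, hstar, hstar, map_mul, mul_inv_rev, Equiv.Perm.mul_apply]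
      simp [mul_assoc]
  have hswap : ∀ a x y : G, star (star a x) y = star (star a y) x := fun a x y => by
    obtain ⟨x, rfl⟩ := (μ a).surjective x
    obtain ⟨y, rfl⟩ := (μ a).surjective y
    rw [hkey, hkey, hcomm x y]
  have hassoc : ∀ a b c : G, star (star a b) c = star a (star b c) := fun a b c => by
    rw [hcomm a b, hswap, hcomm]
  have hinv : ∀ a : G, star a (μ a a⁻¹) = 1 := fun a => by
    rw [← hcocycle, mul_inv_cancel]
  exact ⟨hassoc, hcomm, fun a => ⟨hone a, hcomm a 1 ▸ hone a⟩,
    fun a => ⟨μ a a⁻¹, hinv a, hcomm a _ ▸ hinv a⟩,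
    fun g a b => hcancel g _ _ (by rw [← hkey, hassoc]), hcocycle⟩
end

section
/- Let μ be an IYB morphism of a finite group G. Then for all x, y, z ∈ G one has μ(x)(yz) = μ(x)(y) · μ(μ(y)⁻¹(x⁻¹))⁻¹(z). -/
/-- The operation `x + y = x * μ(x)⁻¹(y)` attached to an IYB morphism satisfies
`(x + y) + z = x * (μ(x)⁻¹(y) + μ(x)⁻¹(z))`. -/
theorem iyb_add_add {G : Type*} [Group G] (μ : G →* Equiv.Perm G) (x y z : G) :
    (x * (μ x)⁻¹ y) * (μ (x * (μ x)⁻¹ y))⁻¹ z =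
      x * ((μ x)⁻¹ y * (μ ((μ x)⁻¹ y))⁻¹ ((μ x)⁻¹ z)) := by
  rw [map_mul, mul_inv_rev, Equiv.Perm.mul_apply, mul_assoc]

/-- The values of an IYB morphism are additive for `x + y = x * μ(x)⁻¹(y)`. -/
theorem iyb_map_add {G : Type*} [Group G] (μ : G →* Equiv.Perm G)
    (hμ : ∀ x y : G, x * (μ x)⁻¹ y = y * (μ y)⁻¹ x) (x y w : G) :
    (μ x)⁻¹ (y * (μ y)⁻¹ w) = (μ x)⁻¹ y * (μ ((μ x)⁻¹ y))⁻¹ ((μ x)⁻¹ w) := by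
  apply mul_left_cancel (a := x)
  rw [← iyb_add_add, hμ x (y * (μ y)⁻¹ w), hμ x y, iyb_add_add, iyb_add_add,
    hμ ((μ y)⁻¹ w)]

/-- If `μ` is an IYB morphism of a finite group `G`, then
`μ(x)(yz) = μ(x)(y) · μ(μ(y)⁻¹(x⁻¹))⁻¹(z)` for all `x, y, z ∈ G`. -/
theorem stmt_2 {G : Type*} [Group G] [Finite G]
    (μ : G →* Equiv.Perm G)
    (hμ : ∀ x y : G, x * (μ x)⁻¹ y = y * (μ y)⁻¹ x) :
    ∀ x y z : G, μ x (y * z) = μ x y * (μ ((μ y)⁻¹ x⁻¹))⁻¹ z := by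
  intro x y z
  have hadd := iyb_map_add μ hμ x⁻¹ y (μ y z)
  have hcomm := hμ y x⁻¹
  rw [← Equiv.Perm.mul_apply (μ y)⁻¹, inv_mul_cancel, Equiv.Perm.one_apply] at hadd
  simp only [map_inv, inv_inv] at hadd hcomm
  have hval : (μ y)⁻¹ x⁻¹ = y⁻¹ * (x⁻¹ * μ x y) := by
    rw [← hcomm, inv_mul_cancel_left]
  rw [hadd, hval]
  simp only [map_mul, map_inv, mul_inv_rev, inv_inv, Equiv.Perm.mul_apply]
end

section
/- Let G be a group and A an abelian group. Let α : G → Sym(A) be a group homomorphism into the symmetric group on the underlying set of A, and suppose there is a bijection π : G → A satisfying π(gh) = π(g) + α(g)(π(h)) for all g, h ∈ G. Then for every g ∈ G the map α(g) : A → A is a group automorphism of A, i.e. α(g)(a + b) = α(g)(a) + α(g)(b) for all a, b ∈ A. -/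
/-- Let `G` be a group and `A` an abelian group. If `α : G → Sym(A)`
is a group homomorphism into the group of bijections of the underlying set of `A`
and there is a bijection `π : G → A` with `π(gh) = π(g) + α(g)(π(h))`, then each
`α(g)` is automatically a group automorphism of `A`. -/
theorem stmt_3 {G A : Type*} [Group G] [AddCommGroup A]
    (α : G →* Equiv.Perm A) (π : G ≃ A)
    (hπ : ∀ g h : G, π (g * h) = π g + α g (π h)) :
    ∀ (g : G) (a b : A), α g (a + b) = α g a + α g b := by
  intro g a b
  obtain ⟨h, rfl⟩ := π.surjective b
  obtain ⟨k, rfl⟩ : ∃ k, α h (π k) = a :=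
    ⟨π.symm ((α h).symm a), by simp⟩
  have key := hπ (g * h) k
  rw [mul_assoc, hπ g (h * k), hπ g h, hπ h k, map_mul, Equiv.Perm.mul_apply,
    add_assoc] at key
  rw [add_comm (α h (π k)), add_left_cancel key, add_comm]
end

section
/- Let X be a finite set and let λ : X → Sym(X) be an IYB map. Let ψ : Sym(X) → Sym(X × X) be the injective group homomorphism given by ψ(τ)(x, y) = (τ(x), λ(τ(x))⁻¹(τ(λ(x)(y)))), and define λ₂ : X × X → Sym(X × X) by λ₂(x, y) = ψ(λ(x) ∘ λ(y)). Then λ₂ is an IYB map on the finite set X × X, i.e. λ₂(u) ∘ λ₂(λ₂(u)⁻¹(v)) = λ₂(v) ∘ λ₂(λ₂(v)⁻¹(u)) for all u, v ∈ X × X. -/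
/-- Multiplying by `l` of a pulled-back point is right commutative when `l` is an IYB map. -/
theorem mul_apply_inv_right_comm {X : Type*} (l : X → Equiv.Perm X)
    (hl : ∀ x y : X, l x * l ((l x)⁻¹ y) = l y * l ((l y)⁻¹ x)) (g : Equiv.Perm X) (x y : X) :
    g * l (g⁻¹ x) * l ((g * l (g⁻¹ x))⁻¹ y) = g * l (g⁻¹ y) * l ((g * l (g⁻¹ y))⁻¹ x) := by
  simp only [mul_inv_rev, Equiv.Perm.mul_apply, mul_assoc]
  rw [hl]

/-- If `λ : X → Sym(X)` is an IYB map on a finite set `X`,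
`ψ : Sym(X) → Sym(X × X)` is the injective homomorphism
`ψ(τ)(x, y) = (τ(x), λ(τ(x))⁻¹(τ(λ(x)(y))))`, and `λ₂(x, y) = ψ(λ(x) ∘ λ(y))`,
then `λ₂` is an IYB map on `X × X`. -/
theorem stmt_19 {X : Type*} [Finite X] (l : X → Equiv.Perm X)
    (hl : ∀ x y : X, l x * l ((l x)⁻¹ y) = l y * l ((l y)⁻¹ x))
    (ψ : Equiv.Perm X →* Equiv.Perm (X × X))
    (hψ : ∀ (τ : Equiv.Perm X) (p : X × X), ψ τ p = (τ p.1, (l (τ p.1))⁻¹ (τ (l p.1 p.2))))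
    (l2 : X × X → Equiv.Perm (X × X))
    (hl2 : ∀ p : X × X, l2 p = ψ (l p.1 * l p.2)) :
    ∀ u v : X × X, l2 u * l2 ((l2 u)⁻¹ v) = l2 v * l2 ((l2 v)⁻¹ u) := by
  let s : Equiv.Perm X → X → Equiv.Perm X := fun g x => g * l (g⁻¹ x)
  have s_comm : ∀ g x y, s (s g x) y = s (s g y) x := mul_apply_inv_right_comm l hl
  have l_mul : ∀ p : X × X, l p.1 * l p.2 = s (s 1 p.1) (l p.1 p.2) := by
    intro p
    simp only [s, inv_one, one_mul, Equiv.Perm.one_apply,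
      ← Equiv.Perm.mul_apply, inv_mul_cancel]
  have l2_mul : ∀ u v : X × X,
      l2 u * l2 ((l2 u)⁻¹ v) = ψ (s (s (s (s 1 u.1) (l u.1 u.2)) v.1) (l v.1 v.2)) := by
    intro u v
    rw [hl2 ((l2 u)⁻¹ v), hl2 u, ← map_inv, hψ, ← map_mul, ← l_mul u]
    simp only [s, mul_inv_rev, Equiv.Perm.mul_apply, mul_assoc]
  intro u v
  rw [l2_mul, l2_mul, s_comm (s 1 u.1) (l u.1 u.2) v.1, s_comm 1 u.1 v.1,
    s_comm (s (s 1 v.1) u.1) (l u.1 u.2) (l v.1 v.2), s_comm (s 1 v.1) u.1 (l v.1 v.2)]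
end
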